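/- arXiv:math/0305313 — 2 statements merged into one kernel-verified Lean document; each statement's English description precedes it below -/
import Mathlib

section
/- If μ is a CCF-invariant probability measure on Ω₁, then for every α > 2/5 one has ∫_{Ω₁} Σ_{i≥1} pᵢ^α dμ(p) < ∞. -/
open MeasureTheory ENNReal Filter Set

noncomputable section

/-- The nonincreasing rearrangement of a nonnegative summable sequence:
`dRearrange x n` is the `(n+1)`-th largest value of `x` (zeros being ignored
when there are infinitely many positive entries). -/
def dRearrange (x : ℕ → ℝ) (n : ℕ) : ℝ :=
  sInf {t : ℝ | {i | t < x i}.Finite ∧ Nat.card {i | t < x i} ≤ n}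

/-- The space `Ω₁` of ordered partitions of `[0,1]`:
nonincreasing nonnegative sequences of sum `1`. -/
def Omega1 : Set (ℕ → ℝ) :=
  {p | (∀ i, 0 ≤ p i) ∧ Antitone p ∧ ∑' i, p i = 1}

/-- Result of merging parts `i` and `j` of `p`, rearranged nonincreasingly. -/
def mergeSeq (p : ℕ → ℝ) (i j : ℕ) : ℕ → ℝ :=
  dRearrange (fun m => if m = i then p i + p j else if m = j then 0 else p m)

/-- Result of splitting part `i` of `p` into `u * p i` and `(1 - u) * p i`,
rearranged nonincreasingly. -/
def splitSeq (p : ℕ → ℝ) (i : ℕ) (u : ℝ) : ℕ → ℝ :=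
  dRearrange (fun m =>
    if m = 0 then u * p i else if m = 1 then (1 - u) * p i
    else if m - 2 = i then 0 else p (m - 2))

/-- One-step transition kernel of the continuous coagulation-fragmentation (CCF)
chain: `CCFstep p A` is the probability that, starting from `p`, the next state
lies in `A`.  Two parts are size-biased sampled with replacement (part `i` has
probability `p i` at each draw); two distinct sampled parts are merged, while a
twice-sampled part is split by an independent uniform `u ∈ [0,1]`; the result
is rearranged nonincreasingly. -/
def CCFstep (p : ℕ → ℝ) (A : Set (ℕ → ℝ)) : ℝ≥0∞ :=
  ∑' i : ℕ, ∑' j : ℕ,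
    if i ≠ j then
      ENNReal.ofReal (p i * p j) * A.indicator (fun _ => (1 : ℝ≥0∞)) (mergeSeq p i j)
    else
      ENNReal.ofReal (p i ^ 2) *
        ∫⁻ u in Set.Icc (0:ℝ) 1, A.indicator (fun _ => (1 : ℝ≥0∞)) (splitSeq p i u)

/-- A probability measure `μ` on `Ω₁` is CCF-invariant if it is a stationary
distribution of the CCF chain. -/
def CCFInvariant (μ : Measure (ℕ → ℝ)) : Prop :=
  IsProbabilityMeasure μ ∧ μ Omega1 = 1 ∧
    ∀ A : Set (ℕ → ℝ), MeasurableSet A → ∫⁻ p, CCFstep p A ∂μ = μ A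

/-- The indicator of `ε ≤ x`. -/
def atLeast (ε x : ℝ) : ℝ≥0∞ := if ε ≤ x then 1 else 0

/-- The indicator of `x < ε`. -/
def below (ε x : ℝ) : ℝ≥0∞ := if ε ≤ x then 0 else 1

/-- The number of parts of `x` of size at least `ε`. -/
def partCount (ε : ℝ) (x : ℕ → ℝ) : ℝ≥0∞ := ∑' i, atLeast ε (x i)

/-- The total mass of the parts of `p` of size at least `ε`. -/
def largeMass (ε : ℝ) (p : ℕ → ℝ) : ℝ≥0∞ := ∑' i, ENNReal.ofReal (p i) * atLeast ε (p i)

/-- The total mass of the parts of `p` of size less than `ε`. -/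
def smallMass (ε : ℝ) (p : ℕ → ℝ) : ℝ≥0∞ := ∑' i, ENNReal.ofReal (p i) * below ε (p i)

/-- The sum of squares of the parts of `p` of size at least `ε`. -/
def largeSq (ε : ℝ) (p : ℕ → ℝ) : ℝ≥0∞ := ∑' i, ENNReal.ofReal (p i) ^ 2 * atLeast ε (p i)

/-- The parts obtained by merging parts `i` and `j` of `p`, not rearranged. -/
def mergeParts (p : ℕ → ℝ) (i j : ℕ) : ℕ → ℝ :=
  fun m => if m = i then p i + p j else if m = j then 0 else p m

/-- The parts obtained by splitting part `i` of `p`, not rearranged. -/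
def splitParts (p : ℕ → ℝ) (i : ℕ) (u : ℝ) : ℕ → ℝ :=
  fun m => if m = 0 then u * p i else if m = 1 then (1 - u) * p i
    else if m - 2 = i then 0 else p (m - 2)

lemma mergeSeq_eq (p : ℕ → ℝ) (i j : ℕ) : mergeSeq p i j = dRearrange (mergeParts p i j) := rfl

lemma splitSeq_eq (p : ℕ → ℝ) (i : ℕ) (u : ℝ) :
    splitSeq p i u = dRearrange (splitParts p i u) := rfl

@[fun_prop]
lemma measurable_atLeast (ε : ℝ) : Measurable (atLeast ε) :=
  Measurable.ite measurableSet_Ici measurable_const measurable_const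

@[fun_prop]
lemma measurable_below (ε : ℝ) : Measurable (below ε) :=
  Measurable.ite measurableSet_Ici measurable_const measurable_const

lemma atLeast_add_below (ε x : ℝ) : atLeast ε x + below ε x = 1 := by
  unfold atLeast below; split_ifs <;> simp

lemma below_le_one (ε x : ℝ) : below ε x ≤ 1 := by
  unfold below; split_ifs <;> simp

lemma atLeast_le_one (ε x : ℝ) : atLeast ε x ≤ 1 := by
  unfold atLeast; split_ifs <;> simp

lemma atLeast_of_nonpos {ε x : ℝ} (hε : 0 < ε) (hx : x ≤ 0) : atLeast ε x = 0 :=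
  if_neg (by linarith)

section Rearrangement

variable {x : ℕ → ℝ} {ε : ℝ}

lemma le_dRearrange_iff (hx : ∀ t, 0 < t → {i | t ≤ x i}.Finite) (h0 : ∀ i, 0 ≤ x i)
    (hε : 0 < ε) (n : ℕ) : ε ≤ dRearrange x n ↔ n < {i | ε ≤ x i}.ncard := by
  have hfin : ∀ t, 0 < t → {i | t < x i}.Finite := fun t ht =>
    (hx t ht).subset fun i (hi : t < x i) => hi.le
  have hbdd : BddBelow {t : ℝ | {i | t < x i}.Finite ∧ Nat.card {i | t < x i} ≤ n} := by
    refine ⟨0, fun t ht => ?_⟩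
    by_contra! h
    have : {i | t < x i} = univ := eq_univ_of_forall fun i => h.trans_le (h0 i)
    exact infinite_univ (this ▸ ht.1)
  constructor
  · intro h
    by_contra! hn
    have hF : {i | ε / 2 ≤ x i ∧ x i < ε}.Finite :=
      (hx (ε / 2) (by linarith)).subset fun i hi => hi.1
    obtain ⟨t, ht1, ht2, ht⟩ : ∃ t, 0 < t ∧ t < ε ∧ ∀ i, x i < ε → x i ≤ t := by
      obtain ⟨t, ht⟩ := ((hF.image x).insert (ε / 2)).exists_maximal
        ⟨ε / 2, mem_insert _ _⟩
      have hge : ε / 2 ≤ t := by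
        rcases le_total (ε / 2) t with h' | h'
        · exact h'
        · exact ht.2 (mem_insert _ _) h'
      refine ⟨t, by linarith, ?_, fun i hi => ?_⟩
      · rcases ht.1 with h' | ⟨i, hi, rfl⟩
        · rw [h']; linarith
        · exact hi.2
      · by_cases h' : ε / 2 ≤ x i
        · rcases le_total (x i) t with h'' | h''
          · exact h''
          · exact ht.2 (mem_insert_of_mem _ ⟨i, ⟨h', hi⟩, rfl⟩) h''
        · linarith
    have heq : {i | t < x i} = {i | ε ≤ x i} := by
      ext i
      refine ⟨fun (hi : t < x i) => ?_, fun (hi : ε ≤ x i) => ht2.trans_le hi⟩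
      by_contra hc
      exact absurd (ht i (not_le.1 hc)) (not_le.2 hi)
    have : dRearrange x n ≤ t := csInf_le hbdd ⟨hfin t ht1, by rw [heq]; exact hn⟩
    linarith
  · intro h
    refine le_csInf ?_ ?_
    · obtain ⟨B, hB⟩ := ((hx 1 one_pos).image x).bddAbove
      refine ⟨max B 1, ?_⟩
      have h : {i | max B 1 < x i} = ∅ := by
        ext i
        simp only [mem_ofPred_eq, mem_empty_iff_false, iff_false, not_lt]
        by_cases h1 : 1 ≤ x i
        · exact (hB ⟨i, h1, rfl⟩).trans (le_max_left _ _)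
        · exact (not_le.1 h1).le.trans (le_max_right _ _)
      rw [mem_ofPred_eq, h]
      simp
    · rintro t ⟨ht1, ht2⟩
      by_contra! hc
      have hsub : {i | ε ≤ x i} ⊆ {i | t < x i} := fun i (hi : ε ≤ x i) => hc.trans_le hi
      exact absurd ((Set.ncard_le_ncard hsub ht1).trans ht2) (not_le.2 h)

lemma partCount_eq_ncard (hx : {i | ε ≤ x i}.Finite) :
    partCount ε x = ({i | ε ≤ x i}.ncard : ℝ≥0∞) := by
  have h : partCount ε x = ∑' i, ({i | ε ≤ x i}.indicator (fun _ => (1 : ℝ≥0∞))) i := rfl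
  rw [h, ← tsum_subtype, ENNReal.tsum_set_one, ← hx.cast_ncard_eq]
  rfl

lemma le_dRearrange_iff_partCount (hx : ∀ t, 0 < t → {i | t ≤ x i}.Finite)
    (h0 : ∀ i, 0 ≤ x i) (hε : 0 < ε) (n : ℕ) :
    ε ≤ dRearrange x n ↔ (n : ℝ≥0∞) < partCount ε x := by
  rw [le_dRearrange_iff hx h0 hε, partCount_eq_ncard (hx ε hε), Nat.cast_lt]

lemma sum_indicator_dRearrange (hx : ∀ t, 0 < t → {i | t ≤ x i}.Finite)
    (h0 : ∀ i, 0 ≤ x i) (hε : 0 < ε) {M : ℕ} (hM : partCount ε x ≤ M) :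
    ∑ n ∈ Finset.range M,
      {p : ℕ → ℝ | ε ≤ p n}.indicator (fun _ => (1 : ℝ≥0∞)) (dRearrange x) =
      partCount ε x := by
  rw [partCount_eq_ncard (hx ε hε)] at hM ⊢
  have hM' : {i | ε ≤ x i}.ncard ≤ M := by exact_mod_cast hM
  simp only [indicator_apply, mem_ofPred_eq, le_dRearrange_iff hx h0 hε, Finset.sum_boole]
  congr 2
  have : (Finset.range M).filter (fun n => n < {i | ε ≤ x i}.ncard) =
      Finset.range {i | ε ≤ x i}.ncard := by
    ext n; simp only [Finset.mem_filter, Finset.mem_range]; omega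
  rw [this, Finset.card_range]

end Rearrangement

lemma tsum_eq_add_tsum_ite_zero (f : ℕ → ℝ≥0∞) (i : ℕ) :
    ∑' m, f m = f i + ∑' m, if m = i then 0 else f m := by
  convert ENNReal.tsum_eq_add_tsum_ite (f := f) i

section Counting

variable {p : ℕ → ℝ} {ε : ℝ}

lemma summable_of_mem_Omega1 (hp : p ∈ Omega1) : Summable p := by
  by_contra h
  have := hp.2.2
  rw [tsum_eq_zero_of_not_summable h] at this
  exact zero_ne_one this

lemma tsum_ofReal_of_mem_Omega1 (hp : p ∈ Omega1) : ∑' i, ENNReal.ofReal (p i) = 1 := by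
  rw [← ENNReal.ofReal_tsum_of_nonneg hp.1 (summable_of_mem_Omega1 hp), hp.2.2, ENNReal.ofReal_one]

lemma finite_setOf_le_of_mem_Omega1 (hp : p ∈ Omega1) {t : ℝ} (ht : 0 < t) :
    {i | t ≤ p i}.Finite := by
  have := (summable_of_mem_Omega1 hp).tendsto_cofinite_zero.eventually (gt_mem_nhds ht)
  rw [Filter.eventually_cofinite] at this
  simpa using this

lemma mergeParts_nonneg (hp : p ∈ Omega1) (i j m : ℕ) : 0 ≤ mergeParts p i j m := by
  unfold mergeParts
  split_ifs
  exacts [add_nonneg (hp.1 i) (hp.1 j), le_rfl, hp.1 m]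

lemma splitParts_nonneg (hp : p ∈ Omega1) (i : ℕ) {u : ℝ} (hu : u ∈ Icc (0 : ℝ) 1) (m : ℕ) :
    0 ≤ splitParts p i u m := by
  unfold splitParts
  split_ifs
  exacts [mul_nonneg hu.1 (hp.1 i), mul_nonneg (by linarith [hu.2]) (hp.1 i), le_rfl, hp.1 _]

lemma finite_setOf_le_mergeParts (hp : p ∈ Omega1) (i j : ℕ) {t : ℝ} (ht : 0 < t) :
    {m | t ≤ mergeParts p i j m}.Finite := by
  refine ((finite_setOf_le_of_mem_Omega1 hp ht).insert i).subset fun m hm => ?_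
  simp only [mem_ofPred_eq, mergeParts] at hm
  split_ifs at hm with h1 h2
  · exact Or.inl h1
  · linarith
  · exact Or.inr hm

lemma finite_setOf_le_splitParts (hp : p ∈ Omega1) (i : ℕ) (u : ℝ) {t : ℝ} (ht : 0 < t) :
    {m | t ≤ splitParts p i u m}.Finite := by
  refine ((((finite_setOf_le_of_mem_Omega1 hp ht).image (· + 2)).insert 0).insert 1).subset
    fun m hm => ?_
  simp only [mem_ofPred_eq, splitParts] at hm
  split_ifs at hm with h1 h2 h3
  · exact Or.inr (Or.inl h1)
  · exact Or.inl h2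
  · linarith
  · exact Or.inr (Or.inr ⟨m - 2, hm, by simp only; omega⟩)

lemma partCount_mergeParts_aux (hε : 0 < ε) {i j : ℕ} (hij : i ≠ j) :
    partCount ε (mergeParts p i j) + (atLeast ε (p i) + atLeast ε (p j)) =
      partCount ε p + atLeast ε (p i + p j) := by
  have h1 := tsum_eq_add_tsum_ite_zero (fun m => atLeast ε (mergeParts p i j m)) i
  have h2 := tsum_eq_add_tsum_ite_zero
    (fun m => if m = i then 0 else atLeast ε (mergeParts p i j m)) j
  have h3 := tsum_eq_add_tsum_ite_zero (fun m => atLeast ε (p m)) i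
  have h4 := tsum_eq_add_tsum_ite_zero (fun m => if m = i then 0 else atLeast ε (p m)) j
  have h5 : (fun m => if m = j then 0 else if m = i then 0 else atLeast ε (mergeParts p i j m))
      = fun m => if m = j then 0 else if m = i then 0 else atLeast ε (p m) := by
    ext m
    unfold mergeParts
    split_ifs <;> rfl
  have h6 : mergeParts p i j i = p i + p j := by simp [mergeParts]
  have h7 : mergeParts p i j j = 0 := by simp [mergeParts, hij.symm]
  simp only [hij.symm, if_false] at h2 h4
  rw [h5] at h2
  unfold partCount
  rw [h1, h2, h3, h4, h6, h7, atLeast_of_nonpos hε le_rfl]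
  ring

lemma partCount_mergeParts (hp : p ∈ Omega1) (hε : 0 < ε) {i j : ℕ} (hij : i ≠ j) :
    partCount ε (mergeParts p i j) + atLeast ε (p i) * atLeast ε (p j) =
      partCount ε p + below ε (p i) * below ε (p j) * atLeast ε (p i + p j) := by
  have h := partCount_mergeParts_aux (p := p) hε hij
  have hi := hp.1 i
  have hj := hp.1 j
  by_cases h1 : ε ≤ p i <;> by_cases h2 : ε ≤ p j
  · have h3 : ε ≤ p i + p j := by linarith
    simp only [atLeast, below, h1, h2, h3, if_true] at h ⊢
    rw [← add_assoc] at h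
    simpa using (ENNReal.add_left_inj one_ne_top).1 h
  · have h3 : ε ≤ p i + p j := by linarith
    simp only [atLeast, below, h1, h2, h3, if_true, if_false, add_zero] at h ⊢
    simpa using (ENNReal.add_left_inj one_ne_top).1 h
  · have h3 : ε ≤ p i + p j := by linarith
    simp only [atLeast, below, h1, h2, h3, if_true, if_false, zero_add] at h ⊢
    simpa using (ENNReal.add_left_inj one_ne_top).1 h
  · simpa [atLeast, below, h1, h2] using h

lemma partCount_splitParts (hε : 0 < ε) (i : ℕ) (u : ℝ) :
    partCount ε (splitParts p i u) + atLeast ε (p i) =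
      partCount ε p + (atLeast ε (u * p i) + atLeast ε ((1 - u) * p i)) := by
  unfold partCount
  rw [tsum_eq_zero_add' ENNReal.summable, tsum_eq_zero_add' ENNReal.summable,
    tsum_eq_add_tsum_ite_zero (fun m => atLeast ε (p m)) i]
  have h : (fun m => atLeast ε (splitParts p i u (m + 1 + 1))) =
      fun m => if m = i then 0 else atLeast ε (p m) := by
    ext m
    simp only [splitParts]
    rw [if_neg (by omega), if_neg (by omega), show m + 1 + 1 - 2 = m by omega]
    split_ifs
    · exact atLeast_of_nonpos hε le_rfl
    · rfl
  have h0 : splitParts p i u 0 = u * p i := by simp [splitParts]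
  have h1 : splitParts p i u (0 + 1) = (1 - u) * p i := by simp [splitParts]
  rw [h, h0, h1]
  ring

lemma partCount_mergeParts_le (hε : 0 < ε) {i j : ℕ} (hij : i ≠ j) :
    partCount ε (mergeParts p i j) ≤ partCount ε p + 1 := by
  refine le_self_add.trans ((partCount_mergeParts_aux hε hij).le.trans ?_)
  gcongr
  exact atLeast_le_one _ _

lemma partCount_splitParts_le (hp : p ∈ Omega1) (hε : 0 < ε) (i : ℕ) {u : ℝ}
    (hu : u ∈ Icc (0 : ℝ) 1) :
    partCount ε (splitParts p i u) ≤ partCount ε p + 1 := by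
  have h := partCount_splitParts (p := p) hε i u
  by_cases hi : ε ≤ p i
  · have h1 : partCount ε (splitParts p i u) + 1 ≤ partCount ε p + 1 + 1 := by
      calc _ = partCount ε p + (atLeast ε (u * p i) + atLeast ε ((1 - u) * p i)) := by
            rw [← h, atLeast, if_pos hi]
        _ ≤ partCount ε p + (1 + 1) := by
            gcongr <;> exact atLeast_le_one _ _
        _ = _ := by ring
    exact (ENNReal.add_le_add_iff_right one_ne_top).1 h1
  · have h1 : u * p i ≤ p i := mul_le_of_le_one_left (hp.1 i) hu.2
    have h2 : (1 - u) * p i ≤ p i := mul_le_of_le_one_left (hp.1 i) (by linarith [hu.1])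
    rw [atLeast, atLeast, atLeast, if_neg hi, if_neg (by linarith), if_neg (by linarith)] at h
    simp only [add_zero] at h
    rw [h]
    exact le_self_add

lemma ofReal_mul_partCount_le (hp : p ∈ Omega1) : ENNReal.ofReal ε * partCount ε p ≤ 1 := by
  rw [partCount, ← ENNReal.tsum_mul_left, ← tsum_ofReal_of_mem_Omega1 hp]
  refine ENNReal.tsum_le_tsum fun i => ?_
  unfold atLeast
  split_ifs with h
  · simpa using ENNReal.ofReal_le_ofReal h
  · simp

lemma exists_partCount_bound (hε : 0 < ε) :
    ∃ M : ℕ, ∀ p ∈ Omega1, partCount ε p + 1 ≤ M := by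
  obtain ⟨M, hM⟩ := exists_nat_ge (1 / ε)
  refine ⟨M + 1, fun p hp => ?_⟩
  push_cast
  gcongr
  have h : partCount ε p ≤ (ENNReal.ofReal ε)⁻¹ := by
    rw [ENNReal.le_inv_iff_mul_le, mul_comm]
    exact ofReal_mul_partCount_le hp
  refine h.trans ?_
  rw [← ENNReal.ofReal_inv_of_pos hε, ← ENNReal.ofReal_natCast]
  exact ENNReal.ofReal_le_ofReal (by simpa using hM)

end Counting

/-- The expected number of parts of size at least `ε` after one step of the chain from `p`. -/
def nextCount (ε : ℝ) (p : ℕ → ℝ) : ℝ≥0∞ :=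
  ∑' i : ℕ, ∑' j : ℕ,
    if i ≠ j then ENNReal.ofReal (p i * p j) * partCount ε (mergeParts p i j)
    else ENNReal.ofReal (p i ^ 2) * ∫⁻ u in Set.Icc (0 : ℝ) 1, partCount ε (splitParts p i u)

/-- The expected decrease of the number of parts of size at least `ε` (up to a common term with
`countGain`). -/
def countLoss (ε : ℝ) (p : ℕ → ℝ) : ℝ≥0∞ :=
  ∑' i : ℕ, ∑' j : ℕ,
    if i ≠ j then ENNReal.ofReal (p i) * ENNReal.ofReal (p j) *
      (atLeast ε (p i) * atLeast ε (p j))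
    else 2 * ENNReal.ofReal ε * (ENNReal.ofReal (p i) * atLeast ε (p i))

/-- The expected increase of the number of parts of size at least `ε` (up to a common term with
`countLoss`). -/
def countGain (ε : ℝ) (p : ℕ → ℝ) : ℝ≥0∞ :=
  ∑' i : ℕ, ∑' j : ℕ,
    if i ≠ j then ENNReal.ofReal (p i) * ENNReal.ofReal (p j) *
      (below ε (p i) * below ε (p j) * atLeast ε (p i + p j))
    else ENNReal.ofReal (p i) ^ 2 * atLeast ε (p i)

@[fun_prop]
lemma measurable_partCount (ε : ℝ) : Measurable (partCount ε) :=
  Measurable.tsum fun i => by fun_prop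

@[fun_prop]
lemma measurable_largeMass (ε : ℝ) : Measurable (largeMass ε) :=
  Measurable.tsum fun i => by fun_prop

@[fun_prop]
lemma measurable_smallMass (ε : ℝ) : Measurable (smallMass ε) :=
  Measurable.tsum fun i => by fun_prop

@[fun_prop]
lemma measurable_largeSq (ε : ℝ) : Measurable (largeSq ε) :=
  Measurable.tsum fun i => by fun_prop

@[fun_prop]
lemma measurable_countLoss (ε : ℝ) : Measurable (countLoss ε) :=
  Measurable.tsum fun i => Measurable.tsum fun j => by
    split_ifs <;> fun_prop

@[fun_prop]
lemma measurable_countGain (ε : ℝ) : Measurable (countGain ε) :=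
  Measurable.tsum fun i => Measurable.tsum fun j => by
    split_ifs <;> fun_prop

lemma measurable_splitParts (p : ℕ → ℝ) (i : ℕ) : Measurable (splitParts p i) := by
  refine measurable_pi_lambda _ fun m => ?_
  unfold splitParts
  split_ifs <;> fun_prop

lemma tsum_tsum_ofReal_mul {p : ℕ → ℝ} (hp : p ∈ Omega1) :
    ∑' i, ∑' j, ENNReal.ofReal (p i) * ENNReal.ofReal (p j) = 1 := by
  simp_rw [ENNReal.tsum_mul_left, tsum_ofReal_of_mem_Omega1 hp, mul_one]
  exact tsum_ofReal_of_mem_Omega1 hp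

lemma ofReal_mul_lintegral_atLeast {ε a : ℝ} (hε : 0 < ε) (ha : 0 ≤ a) :
    ENNReal.ofReal a * ∫⁻ u in Set.Icc (0 : ℝ) 1, atLeast ε (u * a) =
      ENNReal.ofReal (a - ε) := by
  rcases ha.eq_or_lt with rfl | ha
  · rw [ENNReal.ofReal_of_nonpos (by linarith : 0 - ε ≤ 0)]
    simp
  have h : (fun u => atLeast ε (u * a)) = (Ici (ε / a)).indicator 1 := by
    ext u
    simp [atLeast, indicator_apply, div_le_iff₀ ha]
  rw [h, lintegral_indicator_one measurableSet_Ici, Measure.restrict_apply measurableSet_Ici]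
  have h' : Ici (ε / a) ∩ Icc 0 1 = Icc (ε / a) 1 := by
    ext u
    simp only [mem_inter_iff, mem_Ici, mem_Icc]
    exact ⟨fun h => ⟨h.1, h.2.2⟩, fun h => ⟨h.1, (by positivity : 0 ≤ ε / a).trans h.1, h.2⟩⟩
  rw [h', Real.volume_Icc, ← ENNReal.ofReal_mul ha.le]
  congr 1
  field_simp

lemma ofReal_mul_lintegral_atLeast_one_sub {ε a : ℝ} (hε : 0 < ε) (ha : 0 ≤ a) :
    ENNReal.ofReal a * ∫⁻ u in Set.Icc (0 : ℝ) 1, atLeast ε ((1 - u) * a) =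
      ENNReal.ofReal (a - ε) := by
  rcases ha.eq_or_lt with rfl | ha
  · rw [ENNReal.ofReal_of_nonpos (by linarith : 0 - ε ≤ 0)]
    simp
  have h : (fun u => atLeast ε ((1 - u) * a)) = (Iic (1 - ε / a)).indicator 1 := by
    ext u
    have : ε ≤ (1 - u) * a ↔ u ≤ 1 - ε / a := by
      rw [← div_le_iff₀ ha]; constructor <;> intro h <;> linarith
    simp [atLeast, indicator_apply, this]
  rw [h, lintegral_indicator_one measurableSet_Iic, Measure.restrict_apply measurableSet_Iic]
  have h' : Iic (1 - ε / a) ∩ Icc 0 1 = Icc 0 (1 - ε / a) := by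
    ext u
    simp only [mem_inter_iff, mem_Iic, mem_Icc]
    have : 0 < ε / a := by positivity
    exact ⟨fun h => ⟨h.2.1, h.1⟩, fun h => ⟨h.2, h.1, by linarith⟩⟩
  rw [h', Real.volume_Icc, ← ENNReal.ofReal_mul ha.le]
  congr 1
  field_simp
  ring

section Balance

variable {p : ℕ → ℝ} {ε : ℝ}

lemma ofReal_sub_mul_add (ha : 0 < ε) (a : ℝ) :
    ENNReal.ofReal (a - ε) + ENNReal.ofReal ε * atLeast ε a =
      ENNReal.ofReal a * atLeast ε a := by
  unfold atLeast
  split_ifs with h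
  · rw [mul_one, mul_one, ← ENNReal.ofReal_add (by linarith) ha.le, sub_add_cancel]
  · rw [ENNReal.ofReal_of_nonpos (by linarith)]; simp

lemma lintegral_partCount_splitParts (hp : p ∈ Omega1) (hε : 0 < ε) (i : ℕ) :
    ENNReal.ofReal (p i ^ 2) * (∫⁻ u in Set.Icc (0 : ℝ) 1, partCount ε (splitParts p i u)) +
        2 * ENNReal.ofReal ε * (ENNReal.ofReal (p i) * atLeast ε (p i)) =
      ENNReal.ofReal (p i) * ENNReal.ofReal (p i) * partCount ε p +
        ENNReal.ofReal (p i) ^ 2 * atLeast ε (p i) := by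
  set q := ENNReal.ofReal (p i) with hq
  set I := ∫⁻ u in Set.Icc (0 : ℝ) 1, partCount ε (splitParts p i u) with hI
  have h1 : I + atLeast ε (p i) = partCount ε p +
      ((∫⁻ u in Set.Icc (0 : ℝ) 1, atLeast ε (u * p i)) +
        ∫⁻ u in Set.Icc (0 : ℝ) 1, atLeast ε ((1 - u) * p i)) := by
    have h := lintegral_congr (μ := volume.restrict (Icc (0 : ℝ) 1))
      fun u => partCount_splitParts (p := p) hε i u
    rw [lintegral_add_right _ measurable_const, lintegral_add_left measurable_const,
      lintegral_add_left (by fun_prop)] at h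
    simpa using h
  have h2 := ofReal_mul_lintegral_atLeast hε (hp.1 i)
  have h3 := ofReal_mul_lintegral_atLeast_one_sub hε (hp.1 i)
  have h4 := ofReal_sub_mul_add hε (p i)
  rw [ENNReal.ofReal_pow (hp.1 i)]
  have hfin : q ^ 2 * atLeast ε (p i) ≠ ⊤ :=
    ENNReal.mul_ne_top (by simp [hq]) ((atLeast_le_one _ _).trans_lt one_lt_top).ne
  rw [← ENNReal.add_left_inj hfin]
  calc q ^ 2 * I + 2 * ENNReal.ofReal ε * (q * atLeast ε (p i)) + q ^ 2 * atLeast ε (p i)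
      = q ^ 2 * (I + atLeast ε (p i)) + 2 * q * (ENNReal.ofReal ε * atLeast ε (p i)) := by ring
    _ = q ^ 2 * partCount ε p + q * (q * ∫⁻ u in Set.Icc (0 : ℝ) 1, atLeast ε (u * p i)) +
        q * (q * ∫⁻ u in Set.Icc (0 : ℝ) 1, atLeast ε ((1 - u) * p i)) +
        2 * q * (ENNReal.ofReal ε * atLeast ε (p i)) := by rw [h1]; ring
    _ = q ^ 2 * partCount ε p + 2 * q * (ENNReal.ofReal (p i - ε) +
        ENNReal.ofReal ε * atLeast ε (p i)) := by rw [h2, h3]; ring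
    _ = _ := by rw [h4]; ring

lemma nextCount_add_countLoss (hp : p ∈ Omega1) (hε : 0 < ε) :
    nextCount ε p + countLoss ε p = partCount ε p + countGain ε p := by
  have h : partCount ε p =
      ∑' i, ∑' j, ENNReal.ofReal (p i) * ENNReal.ofReal (p j) * partCount ε p := by
    simp_rw [ENNReal.tsum_mul_right]
    rw [tsum_tsum_ofReal_mul hp, one_mul]
  conv_rhs => rw [h]
  unfold nextCount countLoss countGain
  simp_rw [← ENNReal.tsum_add]
  refine tsum_congr fun i => tsum_congr fun j => ?_
  by_cases hij : i = j
  · subst hij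
    simpa using lintegral_partCount_splitParts hp hε i
  · simp only [ne_eq, hij, not_false_eq_true, if_true]
    rw [ENNReal.ofReal_mul (hp.1 i), ← mul_add, ← mul_add, partCount_mergeParts hp hε hij]

lemma countLoss_add_largeSq :
    countLoss ε p + largeSq ε p = largeMass ε p ^ 2 + 2 * ENNReal.ofReal ε * largeMass ε p := by
  have h1 : largeSq ε p = ∑' i, ∑' j, if j = i then
      ENNReal.ofReal (p i) ^ 2 * atLeast ε (p i) else 0 := by
    simp [largeSq]
  have h2 : 2 * ENNReal.ofReal ε * largeMass ε p = ∑' i, ∑' j, if j = i then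
      2 * ENNReal.ofReal ε * (ENNReal.ofReal (p i) * atLeast ε (p i)) else 0 := by
    simp [largeMass, ENNReal.tsum_mul_left]
  have h3 : largeMass ε p ^ 2 = ∑' i, ∑' j, (ENNReal.ofReal (p i) * atLeast ε (p i)) *
      (ENNReal.ofReal (p j) * atLeast ε (p j)) := by
    simp_rw [ENNReal.tsum_mul_left, ENNReal.tsum_mul_right, sq]
    rfl
  rw [h1, h2, h3]
  unfold countLoss
  simp_rw [← ENNReal.tsum_add]
  refine tsum_congr fun i => tsum_congr fun j => ?_
  by_cases hij : i = j
  · subst hij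
    have : atLeast ε (p i) * atLeast ε (p i) = atLeast ε (p i) := by
      unfold atLeast; split_ifs <;> simp
    simp only [ne_eq, not_true_eq_false, if_true, if_false]
    rw [mul_mul_mul_comm (ENNReal.ofReal (p i)), this, add_comm, sq]
  · simp only [ne_eq, hij, Ne.symm hij, not_false_eq_true, if_true, if_false, add_zero]
    ring

lemma largeSq_le_countGain : largeSq ε p ≤ countGain ε p :=
  ENNReal.tsum_le_tsum fun i => by
    refine le_trans ?_ (ENNReal.le_tsum i)
    simp

lemma countGain_le : countGain ε p ≤ smallMass ε p ^ 2 + largeSq ε p := by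
  have h1 : largeSq ε p = ∑' i, ∑' j, if j = i then
      ENNReal.ofReal (p i) ^ 2 * atLeast ε (p i) else 0 := by
    simp [largeSq]
  have h3 : smallMass ε p ^ 2 = ∑' i, ∑' j, (ENNReal.ofReal (p i) * below ε (p i)) *
      (ENNReal.ofReal (p j) * below ε (p j)) := by
    simp_rw [ENNReal.tsum_mul_left, ENNReal.tsum_mul_right, sq]
    rfl
  rw [h1, h3]
  unfold countGain
  simp_rw [← ENNReal.tsum_add]
  refine ENNReal.tsum_le_tsum fun i => ENNReal.tsum_le_tsum fun j => ?_
  by_cases hij : i = j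
  · subst hij
    simp
  · simp only [ne_eq, hij, Ne.symm hij, not_false_eq_true, if_true, if_false, add_zero]
    rw [mul_mul_mul_comm (ENNReal.ofReal (p i)) (below ε (p i))]
    exact mul_le_mul_right (mul_le_of_le_one_right' (atLeast_le_one _ _)) _

lemma largeMass_add_smallMass (hp : p ∈ Omega1) : largeMass ε p + smallMass ε p = 1 := by
  unfold largeMass smallMass
  rw [← ENNReal.tsum_add, ← tsum_ofReal_of_mem_Omega1 hp]
  exact tsum_congr fun i => by rw [← mul_add, atLeast_add_below, mul_one]

lemma largeMass_le_one (hp : p ∈ Omega1) : largeMass ε p ≤ 1 :=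
  le_self_add.trans (largeMass_add_smallMass hp).le

lemma smallMass_le_one (hp : p ∈ Omega1) : smallMass ε p ≤ 1 :=
  le_add_self.trans (largeMass_add_smallMass hp).le

/-- The sum of the squares of the parts. -/
def sumSq (p : ℕ → ℝ) : ℝ≥0∞ := ∑' i, ENNReal.ofReal (p i) ^ 2

lemma largeSq_le_sumSq : largeSq ε p ≤ sumSq p :=
  ENNReal.tsum_le_tsum fun _ => mul_le_of_le_one_right' (atLeast_le_one _ _)

lemma sumSq_le_largeSq_add : sumSq p ≤ largeSq ε p + ENNReal.ofReal ε * smallMass ε p := by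
  unfold sumSq largeSq smallMass
  rw [← ENNReal.tsum_mul_left, ← ENNReal.tsum_add]
  refine ENNReal.tsum_le_tsum fun i => ?_
  unfold atLeast below
  split_ifs with h
  · simp
  · simp only [mul_zero, mul_one, zero_add, sq]
    gcongr
    exact (not_le.1 h).le

end Balance

section Step

variable {p : ℕ → ℝ} {ε : ℝ}

lemma CCFstep_add_compl_le (hp : p ∈ Omega1) (A : Set (ℕ → ℝ)) :
    CCFstep p A + CCFstep p Aᶜ ≤ 1 := by
  have hA : ∀ x, A.indicator (fun _ => (1 : ℝ≥0∞)) x + Aᶜ.indicator (fun _ => 1) x = 1 :=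
    fun x => by by_cases h : x ∈ A <;> simp [h]
  unfold CCFstep
  simp_rw [← ENNReal.tsum_add]
  refine le_of_le_of_eq ?_ (tsum_tsum_ofReal_mul hp)
  refine ENNReal.tsum_le_tsum fun i => ENNReal.tsum_le_tsum fun j => ?_
  by_cases hij : i = j
  · subst hij
    simp only [ne_eq, not_true_eq_false, if_false]
    rw [← mul_add, ENNReal.ofReal_pow (hp.1 i), sq]
    refine mul_le_of_le_one_right' ((le_lintegral_add _ _).trans ?_)
    simp [hA]
  · simp only [ne_eq, hij, not_false_eq_true, if_true]
    rw [← mul_add, hA, mul_one, ENNReal.ofReal_mul (hp.1 i)]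

lemma sum_CCFstep (hp : p ∈ Omega1) (hε : 0 < ε) {M : ℕ} (hM : partCount ε p + 1 ≤ M) :
    ∑ n ∈ Finset.range M, CCFstep p {x | ε ≤ x n} = nextCount ε p := by
  unfold CCFstep nextCount
  rw [← Summable.tsum_finsetSum fun _ _ => ENNReal.summable]
  refine tsum_congr fun i => ?_
  rw [← Summable.tsum_finsetSum fun _ _ => ENNReal.summable]
  refine tsum_congr fun j => ?_
  by_cases hij : i = j
  · subst hij
    simp only [ne_eq, not_true_eq_false, if_false]
    rw [← Finset.mul_sum]
    congr 1
    have hmeas : ∀ n ∈ Finset.range M, AEMeasurable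
        (fun u => {x : ℕ → ℝ | ε ≤ x n}.indicator (fun _ => (1 : ℝ≥0∞)) (splitSeq p i u))
        (volume.restrict (Icc (0 : ℝ) 1)) := by
      intro n _
      refine AEMeasurable.congr (f := {u | (n : ℝ≥0∞) < partCount ε (splitParts p i u)}.indicator
        fun _ => 1) ?_ ?_
      · refine (measurable_const.indicator ?_).aemeasurable
        exact measurableSet_lt measurable_const
          ((measurable_partCount ε).comp (measurable_splitParts p i))
      · filter_upwards [ae_restrict_mem measurableSet_Icc] with u hu
        simp only [indicator_apply, mem_ofPred_eq, splitSeq_eq,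
          le_dRearrange_iff_partCount (fun t ht => finite_setOf_le_splitParts hp i u ht)
            (splitParts_nonneg hp i hu) hε]
    rw [← lintegral_finsetSum' _ hmeas]
    refine setLIntegral_congr_fun measurableSet_Icc fun u hu => ?_
    exact sum_indicator_dRearrange (fun t ht => finite_setOf_le_splitParts hp i u ht)
      (splitParts_nonneg hp i hu) hε ((partCount_splitParts_le hp hε i hu).trans hM)
  · simp only [ne_eq, hij, not_false_eq_true, if_true]
    rw [← Finset.mul_sum, mergeSeq_eq, sum_indicator_dRearrange
      (fun t ht => finite_setOf_le_mergeParts hp i j ht) (mergeParts_nonneg hp i j) hε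
      ((partCount_mergeParts_le hε hij).trans hM)]

lemma sum_lintegral_le {Ω ι : Type*} [MeasurableSpace Ω] (μ : Measure Ω) (s : Finset ι)
    (f : ι → Ω → ℝ≥0∞) : ∑ i ∈ s, ∫⁻ x, f i x ∂μ ≤ ∫⁻ x, ∑ i ∈ s, f i x ∂μ := by
  classical
  induction s using Finset.induction_on with
  | empty => simp
  | insert a s ha ih =>
    simp_rw [Finset.sum_insert ha]
    exact (add_le_add_right ih _).trans (le_lintegral_add _ _)

variable {μ : Measure (ℕ → ℝ)}

lemma measurableSet_Omega1 : MeasurableSet Omega1 := by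
  have h : Omega1 = {p | ∀ i, 0 ≤ p i} ∩ ({p | ∀ n, p (n + 1) ≤ p n} ∩ {p | ∑' i, p i = 1}) := by
    ext p
    exact ⟨fun h => ⟨h.1, fun n => h.2.1 n.le_succ, h.2.2⟩,
      fun h => ⟨h.1, antitone_nat_of_succ_le h.2.1, h.2.2⟩⟩
  rw [h]
  refine MeasurableSet.inter ?_ (MeasurableSet.inter ?_ ?_)
  · exact measurableSet_setOfPred.2 (Measurable.forall fun i => measurableSet_setOfPred.1
      (measurableSet_le measurable_const (measurable_pi_apply i)))
  · exact measurableSet_setOfPred.2 (Measurable.forall fun n => measurableSet_setOfPred.1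
      (measurableSet_le (measurable_pi_apply _) (measurable_pi_apply n)))
  · exact measurableSet_eq_fun (Measurable.tsum fun i => measurable_pi_apply i) measurable_const

lemma ae_mem_Omega1 (hμ : CCFInvariant μ) : ∀ᵐ p ∂μ, p ∈ Omega1 := by
  have := hμ.1
  exact (mem_ae_iff_prob_eq_one measurableSet_Omega1).2 hμ.2.1

lemma lintegral_nextCount (hμ : CCFInvariant μ) (hε : 0 < ε) :
    ∫⁻ p, nextCount ε p ∂μ = ∫⁻ p, partCount ε p ∂μ ∧ ∫⁻ p, partCount ε p ∂μ ≠ ⊤ := by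
  obtain ⟨M, hM⟩ := exists_partCount_bound hε
  have hprob := hμ.1
  have hΩ := ae_mem_Omega1 hμ
  let A : ℕ → Set (ℕ → ℝ) := fun n => {x | ε ≤ x n}
  have hA : ∀ n, MeasurableSet (A n) := fun n =>
    measurableSet_le measurable_const (measurable_pi_apply n)
  have hcount : ∫⁻ p, partCount ε p ∂μ = ∑ n ∈ Finset.range M, μ (A n) := by
    have h : partCount ε =ᵐ[μ] fun p => ∑ n ∈ Finset.range M, (A n).indicator (fun _ => 1) p := by
      filter_upwards [hΩ] with p hp
      refine tsum_eq_sum fun n hn => if_neg fun hle => hn ?_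
      have hcard : ((n + 1 : ℕ) : ℝ≥0∞) ≤ M := by
        calc ((n + 1 : ℕ) : ℝ≥0∞) = ∑ m ∈ Finset.range (n + 1), atLeast ε (p m) := by
              have hone : ∀ m ∈ Finset.range (n + 1), atLeast ε (p m) = 1 := fun m hm =>
                if_pos (hle.trans (hp.2.1 (Finset.mem_range_succ_iff.1 hm)))
              rw [Finset.sum_congr rfl hone]
              simp
          _ ≤ partCount ε p := ENNReal.sum_le_tsum _
          _ ≤ M := le_self_add.trans (hM p hp)
      exact Finset.mem_range.2 (Nat.cast_le.1 hcard)
    rw [lintegral_congr_ae h, lintegral_finsetSum _ fun n _ => measurable_const.indicator (hA n)]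
    exact Finset.sum_congr rfl fun n _ => lintegral_indicator_one (hA n)
  have hnext : ∫⁻ p, nextCount ε p ∂μ =
      ∫⁻ p, ∑ n ∈ Finset.range M, CCFstep p (A n) ∂μ :=
    lintegral_congr_ae (hΩ.mono fun p hp => (sum_CCFstep hp hε (hM p hp)).symm)
  have hle : ∑ n ∈ Finset.range M, μ (A n) ≤
      ∫⁻ p, ∑ n ∈ Finset.range M, CCFstep p (A n) ∂μ := by
    simp_rw [← fun n => hμ.2.2 (A n) (hA n)]
    exact sum_lintegral_le _ _ _
  have hle' : ∑ n ∈ Finset.range M, μ (A n)ᶜ ≤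
      ∫⁻ p, ∑ n ∈ Finset.range M, CCFstep p (A n)ᶜ ∂μ := by
    simp_rw [← fun n => hμ.2.2 (A n)ᶜ (hA n).compl]
    exact sum_lintegral_le _ _ _
  have htotal : ∑ n ∈ Finset.range M, μ (A n) + ∑ n ∈ Finset.range M, μ (A n)ᶜ = M := by
    rw [← Finset.sum_add_distrib]
    simp [measure_add_measure_compl (hA _)]
  have hsum : (∫⁻ p, ∑ n ∈ Finset.range M, CCFstep p (A n) ∂μ) +
      ∫⁻ p, ∑ n ∈ Finset.range M, CCFstep p (A n)ᶜ ∂μ ≤ M := by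
    refine (le_lintegral_add _ _).trans
      ((lintegral_mono_ae (g := fun _ => (M : ℝ≥0∞)) (hΩ.mono fun p hp => ?_)).trans (by simp))
    rw [← Finset.sum_add_distrib]
    exact (Finset.sum_le_sum fun n _ => CCFstep_add_compl_le hp (A n)).trans (by simp)
  have hfin : ∑ n ∈ Finset.range M, μ (A n) ≠ ⊤ := ENNReal.sum_ne_top.2 fun _ _ => by simp
  have hfin' : ∑ n ∈ Finset.range M, μ (A n)ᶜ ≠ ⊤ := ENNReal.sum_ne_top.2 fun _ _ => by simp
  rw [hcount, hnext]
  refine ⟨le_antisymm ?_ hle, hfin⟩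
  rw [← ENNReal.add_le_add_iff_right hfin', htotal]
  exact (add_le_add_right hle' _).trans hsum

lemma lintegral_countLoss (hμ : CCFInvariant μ) (hε : 0 < ε) :
    ∫⁻ p, countLoss ε p ∂μ = ∫⁻ p, countGain ε p ∂μ := by
  obtain ⟨h1, h2⟩ := lintegral_nextCount hμ hε
  have h := lintegral_congr_ae
    ((ae_mem_Omega1 hμ).mono fun p hp => nextCount_add_countLoss hp hε)
  rw [lintegral_add_right _ (by fun_prop), lintegral_add_right _ (by fun_prop), h1] at h
  exact (ENNReal.add_right_inj h2).1 h

lemma lintegral_countLoss_add_largeSq (μ : Measure (ℕ → ℝ)) (ε : ℝ) :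
    ∫⁻ p, countLoss ε p ∂μ + ∫⁻ p, largeSq ε p ∂μ =
      ∫⁻ p, largeMass ε p ^ 2 ∂μ + 2 * ENNReal.ofReal ε * ∫⁻ p, largeMass ε p ∂μ := by
  rw [← lintegral_add_right _ (by fun_prop), ← lintegral_const_mul _ (by fun_prop),
    ← lintegral_add_right _ (by fun_prop)]
  exact lintegral_congr fun p => countLoss_add_largeSq

lemma tendsto_smallMass (hp : p ∈ Omega1) :
    Tendsto (fun k : ℕ => smallMass (1 / ((k : ℝ) + 1)) p) atTop (nhds 0) := by
  simp_rw [smallMass, ← lintegral_count]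
  rw [← lintegral_zero (μ := Measure.count (α := ℕ))]
  refine tendsto_lintegral_of_dominated_convergence (fun i => ENNReal.ofReal (p i))
    (fun _ => measurable_of_countable _)
    (fun k => ae_of_all _ fun i => mul_le_of_le_one_right' (below_le_one _ _)) ?_
    (ae_of_all _ fun i => ?_)
  · rw [lintegral_count, tsum_ofReal_of_mem_Omega1 hp]
    exact one_ne_top
  · rcases (hp.1 i).eq_or_lt with h | h
    · simp [← h]
    · refine tendsto_const_nhds.congr' ?_
      filter_upwards [(tendsto_one_div_add_atTop_nhds_zero_nat (𝕜 := ℝ)).eventually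
        (gt_mem_nhds h)] with k hk
      rw [below, if_pos hk.le, mul_zero]

lemma tendsto_lintegral_smallMass (hμ : CCFInvariant μ) :
    Tendsto (fun k : ℕ => ∫⁻ p, smallMass (1 / ((k : ℝ) + 1)) p ∂μ) atTop (nhds 0) := by
  have := hμ.1
  rw [← lintegral_zero (μ := μ)]
  refine tendsto_lintegral_of_dominated_convergence (fun _ => 1) (fun _ => by fun_prop)
    (fun k => (ae_mem_Omega1 hμ).mono fun p hp => smallMass_le_one hp) (by simp)
    ((ae_mem_Omega1 hμ).mono fun p hp => tendsto_smallMass hp)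

/-- The second moment of an invariant measure is at least `1 / 2` (in fact equal to it). -/
lemma one_le_two_mul_lintegral_sumSq (hμ : CCFInvariant μ) :
    1 ≤ 2 * ∫⁻ p, sumSq p ∂μ := by
  have hprob := hμ.1
  have hbound : ∀ ε, 0 < ε →
      1 ≤ 2 * ∫⁻ p, sumSq p ∂μ + 3 * ∫⁻ p, smallMass ε p ∂μ := by
    intro ε hε
    have h1 : (1 : ℝ≥0∞) ≤ ∫⁻ p, largeMass ε p ^ 2 ∂μ + 2 * ∫⁻ p, smallMass ε p ∂μ := by
      rw [← lintegral_const_mul _ (by fun_prop), ← lintegral_add_right _ (by fun_prop)]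
      calc (1 : ℝ≥0∞) = ∫⁻ _, 1 ∂μ := by simp
        _ ≤ _ := lintegral_mono_ae ((ae_mem_Omega1 hμ).mono fun p hp => ?_)
      calc (1 : ℝ≥0∞) = (largeMass ε p + smallMass ε p) ^ 2 := by
            rw [largeMass_add_smallMass hp, one_pow]
        _ = largeMass ε p ^ 2 + (largeMass ε p * smallMass ε p +
            (largeMass ε p + smallMass ε p) * smallMass ε p) := by ring
        _ ≤ largeMass ε p ^ 2 + (1 * smallMass ε p + 1 * smallMass ε p) := by
            gcongr
            · exact largeMass_le_one hp
            · exact (largeMass_add_smallMass hp).le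
        _ = _ := by ring
    have h2 : ∫⁻ p, countGain ε p ∂μ ≤ ∫⁻ p, smallMass ε p ∂μ + ∫⁻ p, largeSq ε p ∂μ := by
      rw [← lintegral_add_right _ (by fun_prop)]
      refine lintegral_mono_ae ((ae_mem_Omega1 hμ).mono fun p hp => countGain_le.trans ?_)
      gcongr
      rw [sq]
      exact mul_le_of_le_one_right' (smallMass_le_one hp)
    have h3 : ∫⁻ p, largeSq ε p ∂μ ≤ ∫⁻ p, sumSq p ∂μ :=
      lintegral_mono fun p => largeSq_le_sumSq
    calc (1 : ℝ≥0∞) ≤ ∫⁻ p, largeMass ε p ^ 2 ∂μ + 2 * ∫⁻ p, smallMass ε p ∂μ := h1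
      _ ≤ (∫⁻ p, largeMass ε p ^ 2 ∂μ + 2 * ENNReal.ofReal ε * ∫⁻ p, largeMass ε p ∂μ) +
          2 * ∫⁻ p, smallMass ε p ∂μ := by gcongr; exact le_self_add
      _ = (∫⁻ p, countGain ε p ∂μ + ∫⁻ p, largeSq ε p ∂μ) + 2 * ∫⁻ p, smallMass ε p ∂μ := by
          rw [← lintegral_countLoss_add_largeSq, lintegral_countLoss hμ hε]
      _ ≤ ((∫⁻ p, smallMass ε p ∂μ + ∫⁻ p, sumSq p ∂μ) + ∫⁻ p, sumSq p ∂μ) +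
          2 * ∫⁻ p, smallMass ε p ∂μ := by
          gcongr
          exact h2.trans (by gcongr)
      _ = _ := by ring
  have hlim : Tendsto (fun k : ℕ => 2 * ∫⁻ p, sumSq p ∂μ +
      3 * ∫⁻ p, smallMass (1 / ((k : ℝ) + 1)) p ∂μ) atTop
      (nhds (2 * ∫⁻ p, sumSq p ∂μ + 3 * 0)) :=
    tendsto_const_nhds.add (ENNReal.Tendsto.const_mul (tendsto_lintegral_smallMass hμ)
      (Or.inr (by simp)))
  simpa using ge_of_tendsto' hlim fun k => hbound _ (by positivity)

/-- The expected total mass of the parts of size less than `ε` is at most `2 * ε`. -/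
lemma lintegral_smallMass_le (hμ : CCFInvariant μ) (hε : 0 < ε) :
    ∫⁻ p, smallMass ε p ∂μ ≤ 2 * ENNReal.ofReal ε := by
  have hprob := hμ.1
  have hΩ := ae_mem_Omega1 hμ
  have h1 : 2 * ∫⁻ p, largeSq ε p ∂μ ≤
      ∫⁻ p, largeMass ε p ^ 2 ∂μ + 2 * ENNReal.ofReal ε * ∫⁻ p, largeMass ε p ∂μ := by
    rw [← lintegral_countLoss_add_largeSq, lintegral_countLoss hμ hε, two_mul]
    gcongr
    exact largeSq_le_countGain
  have h2 : ∫⁻ p, sumSq p ∂μ ≤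
      ∫⁻ p, largeSq ε p ∂μ + ENNReal.ofReal ε * ∫⁻ p, smallMass ε p ∂μ := by
    rw [← lintegral_const_mul _ (by fun_prop), ← lintegral_add_right _ (by fun_prop)]
    exact lintegral_mono fun p => sumSq_le_largeSq_add
  have h3 : ∫⁻ p, largeMass ε p ∂μ + ∫⁻ p, smallMass ε p ∂μ = 1 := by
    rw [← lintegral_add_right _ (by fun_prop),
      lintegral_congr_ae (hΩ.mono fun p hp => largeMass_add_smallMass hp)]
    simp
  have h4 : (1 : ℝ≥0∞) ≤ ∫⁻ p, largeMass ε p ^ 2 ∂μ + 2 * ENNReal.ofReal ε := by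
    calc (1 : ℝ≥0∞) ≤ 2 * ∫⁻ p, sumSq p ∂μ := one_le_two_mul_lintegral_sumSq hμ
      _ ≤ 2 * (∫⁻ p, largeSq ε p ∂μ + ENNReal.ofReal ε * ∫⁻ p, smallMass ε p ∂μ) := by gcongr
      _ = 2 * ∫⁻ p, largeSq ε p ∂μ + 2 * ENNReal.ofReal ε * ∫⁻ p, smallMass ε p ∂μ := by ring
      _ ≤ (∫⁻ p, largeMass ε p ^ 2 ∂μ + 2 * ENNReal.ofReal ε * ∫⁻ p, largeMass ε p ∂μ) +
          2 * ENNReal.ofReal ε * ∫⁻ p, smallMass ε p ∂μ := by gcongr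
      _ = ∫⁻ p, largeMass ε p ^ 2 ∂μ + 2 * ENNReal.ofReal ε *
          (∫⁻ p, largeMass ε p ∂μ + ∫⁻ p, smallMass ε p ∂μ) := by ring
      _ = _ := by rw [h3, mul_one]
  have h5 : ∫⁻ p, largeMass ε p ^ 2 ∂μ ≤ ∫⁻ p, largeMass ε p ∂μ :=
    lintegral_mono_ae (hΩ.mono fun p hp => by
      rw [sq]; exact mul_le_of_le_one_right' (largeMass_le_one hp))
  have hfin : ∫⁻ p, largeMass ε p ^ 2 ∂μ ≠ ⊤ :=
    ((h5.trans (le_self_add.trans h3.le)).trans_lt one_lt_top).ne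
  rw [← ENNReal.add_le_add_iff_left hfin]
  exact (add_le_add_left h5 _).trans (h3.le.trans h4)

end Step

lemma ofReal_rpow_le_tsum {β x : ℝ} (hβ0 : 0 < β) (hβ : β ≤ 1) (hx0 : 0 ≤ x) (hx : x ≤ 1) :
    ENNReal.ofReal (x ^ β) ≤ ∑' k : ℕ, ENNReal.ofReal (((1 / 2 : ℝ) ^ (k + 1)) ^ (β - 1)) *
      (ENNReal.ofReal x * below (2 * (1 / 2) ^ k) x) := by
  rcases hx0.eq_or_lt with rfl | hx0
  · simp [Real.zero_rpow hβ0.ne']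
  obtain ⟨k, hk1, hk2⟩ := exists_nat_pow_near_of_lt_one hx0 hx (y := (1 / 2 : ℝ))
    (by norm_num) (by norm_num)
  refine le_trans ?_ (ENNReal.le_tsum k)
  have hk : ¬ 2 * (1 / 2 : ℝ) ^ k ≤ x := by
    have : (0 : ℝ) < (1 / 2) ^ k := by positivity
    linarith
  rw [below, if_neg hk, mul_one, ← ENNReal.ofReal_mul (by positivity)]
  refine ENNReal.ofReal_le_ofReal ?_
  calc x ^ β = x ^ (β - 1) * x := by
        rw [← Real.rpow_add_one hx0.ne', sub_add_cancel]
    _ ≤ _ := by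
        refine mul_le_mul_of_nonneg_right ?_ hx0.le
        exact Real.rpow_le_rpow_of_nonpos (by positivity) hk1.le (by linarith)

lemma lintegral_tsum_rpow_lt_top {μ : Measure (ℕ → ℝ)} (hμ : CCFInvariant μ) {β : ℝ}
    (hβ0 : 0 < β) (hβ : β ≤ 1) :
    ∫⁻ p, ∑' i : ℕ, ENNReal.ofReal (p i ^ β) ∂μ < ⊤ := by
  have h1 : ∀ p ∈ Omega1, ∑' i : ℕ, ENNReal.ofReal (p i ^ β) ≤
      ∑' k : ℕ, ENNReal.ofReal (((1 / 2 : ℝ) ^ (k + 1)) ^ (β - 1)) *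
        smallMass (2 * (1 / 2) ^ k) p := by
    intro p hp
    simp_rw [smallMass, ← ENNReal.tsum_mul_left]
    rw [ENNReal.tsum_comm]
    refine ENNReal.tsum_le_tsum fun i => ofReal_rpow_le_tsum hβ0 hβ (hp.1 i) ?_
    rw [← ENNReal.ofReal_le_one, ← tsum_ofReal_of_mem_Omega1 hp]
    exact ENNReal.le_tsum i
  have hgeom : ∀ k : ℕ, ((1 / 2 : ℝ) ^ (k + 1)) ^ (β - 1) * (2 * (2 * (1 / 2) ^ k)) =
      8 * ((1 / 2 : ℝ) ^ β) ^ (k + 1) := by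
    intro k
    have hpos : (0 : ℝ) < (1 / 2) ^ (k + 1) := by positivity
    rw [Real.rpow_sub_one hpos.ne', ← Real.rpow_natCast_mul (by norm_num),
      ← Real.rpow_mul_natCast (by norm_num), mul_comm β, pow_succ]
    field_simp
    norm_num
  have hsum : Summable fun k : ℕ => 8 * ((1 / 2 : ℝ) ^ β) ^ (k + 1) := by
    refine Summable.mul_left _ ((summable_nat_add_iff 1).2 ?_)
    exact summable_geometric_of_lt_one (by positivity)
      (Real.rpow_lt_one (by norm_num) (by norm_num) hβ0)
  calc ∫⁻ p, ∑' i : ℕ, ENNReal.ofReal (p i ^ β) ∂μ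
      ≤ ∫⁻ p, ∑' k : ℕ, ENNReal.ofReal (((1 / 2 : ℝ) ^ (k + 1)) ^ (β - 1)) *
        smallMass (2 * (1 / 2) ^ k) p ∂μ := lintegral_mono_ae ((ae_mem_Omega1 hμ).mono h1)
    _ = ∑' k : ℕ, ENNReal.ofReal (((1 / 2 : ℝ) ^ (k + 1)) ^ (β - 1)) *
        ∫⁻ p, smallMass (2 * (1 / 2) ^ k) p ∂μ := by
        rw [lintegral_tsum fun k => by fun_prop]
        exact tsum_congr fun k => lintegral_const_mul _ (by fun_prop)
    _ ≤ ∑' k : ℕ, ENNReal.ofReal (8 * ((1 / 2 : ℝ) ^ β) ^ (k + 1)) := by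
        refine ENNReal.tsum_le_tsum fun k => ?_
        rw [← hgeom k, ENNReal.ofReal_mul (by positivity), ENNReal.ofReal_mul zero_le_two,
          ENNReal.ofReal_ofNat]
        gcongr
        exact lintegral_smallMass_le hμ (by positivity)
    _ < ⊤ := hsum.tsum_ofReal_lt_top

/-- **Proposition 1.2**: a CCF-invariant probability measure `μ` satisfies
`∫ Σᵢ pᵢ^α dμ < ∞` for every `α > 2/5`. -/
theorem invariant_moment_bound (μ : Measure (ℕ → ℝ)) (hμ : CCFInvariant μ) :
    ∀ α : ℝ, 2 / 5 < α →
      ∫⁻ p, ∑' i : ℕ, ENNReal.ofReal (p i ^ α) ∂μ < ⊤ := by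
  intro α hα
  refine (lintegral_mono_ae ((ae_mem_Omega1 hμ).mono fun p hp =>
    ENNReal.tsum_le_tsum fun i => ENNReal.ofReal_le_ofReal ?_)).trans_lt
    (lintegral_tsum_rpow_lt_top hμ (β := min α 1) (by positivity) (min_le_right _ _))
  have hp1 : p i ≤ 1 := by
    rw [← ENNReal.ofReal_le_one, ← tsum_ofReal_of_mem_Omega1 hp]
    exact ENNReal.le_tsum i
  exact Real.rpow_le_rpow_of_exponent_ge' (hp.1 i) hp1 (by positivity) (min_le_left _ _)

end
end

section
/- (Rearrangement contracts ℓ¹ distance) For any two summable sequences p = (pᵢ)_{i≥1} and q = (qᵢ)_{i≥1} of nonnegative real numbers, Σᵢ |pᵢ − qᵢ| ≥ Σᵢ |p*ᵢ − q*ᵢ|, where p* and q* denote the nonincreasing rearrangements of p and q respectively. -/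
open MeasureTheory ENNReal Filter Set

noncomputable section

/-- The strict superlevel sets of a summable sequence at positive heights are finite. -/
lemma finite_superlevel_of_summable {x : ℕ → ℝ} (hxs : Summable x) {t : ℝ} (ht : 0 < t) :
    {i | t < x i}.Finite := by
  have h : ∀ᶠ i in cofinite, x i < t := hxs.tendsto_cofinite_zero.eventually_lt_const ht
  exact (eventually_cofinite.mp h).subset fun i hi => not_lt.mpr (le_of_lt hi)

/-- Superlevel sets of the rearrangement are initial segments of the same cardinality as the
superlevel sets of the original sequence. -/
lemma lt_dRearrange_iff {x : ℕ → ℝ} (hx : ∀ i, 0 ≤ x i) (hxs : Summable x) {t : ℝ} (ht : 0 < t)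
    (n : ℕ) : t < dRearrange x n ↔ n < {i | t < x i}.ncard := by
  have hfin := finite_superlevel_of_summable hxs ht
  constructor
  · intro h
    by_contra! hn
    refine h.not_ge (csInf_le ⟨0, ?_⟩ ⟨hfin, hn⟩)
    rintro s ⟨hs, -⟩
    by_contra! hs0
    exact infinite_univ (hs.subset fun i _ => hs0.trans_le (hx i))
  · intro h
    have hne : {i | t < x i}.Nonempty := (ncard_pos hfin).mp (n.zero_le.trans_lt h)
    obtain ⟨m, hm, hmin⟩ := exists_min_image _ x hfin hne
    refine lt_of_lt_of_le hm (le_csInf ⟨∑' i, x i, ?_⟩ ?_)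
    · have : {i | ∑' i, x i < x i} = ∅ :=
        eq_empty_of_forall_notMem fun i hi =>
          (hxs.le_tsum i fun j _ => hx j).not_gt hi
      simp [this]
    · rintro s ⟨hs, hcard⟩
      by_contra! hsm
      exact (h.trans_le (ncard_le_ncard (fun i hi => hsm.trans_le (hmin i hi)) hs)).not_ge hcard

lemma dRearrange_nonneg {x : ℕ → ℝ} (hx : ∀ i, 0 ≤ x i) (n : ℕ) : 0 ≤ dRearrange x n := by
  refine Real.sInf_nonneg ?_
  rintro s ⟨hs, -⟩
  by_contra! hs0
  exact infinite_univ (hs.subset fun i _ => hs0.trans_le (hx i))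

/-- Among finite sets of given cardinalities, initial segments have the smallest symmetric
difference. -/
lemma encard_symmDiff_Iio_ncard_le {α : Type*} {A B : Set α} (hA : A.Finite) (hB : B.Finite) :
    (symmDiff (Iio A.ncard) (Iio B.ncard)).encard ≤ (symmDiff A B).encard := by
  wlog h : A.ncard ≤ B.ncard generalizing A B
  · rw [symmDiff_comm, symmDiff_comm A]
    exact this hB hA (le_of_not_ge h)
  have hI : symmDiff (Iio A.ncard) (Iio B.ncard) = Ico A.ncard B.ncard := by
    ext n
    simp only [mem_symmDiff, mem_Iio, mem_Ico]
    omega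
  rw [hI]
  refine le_trans ?_ (encard_le_encard (subset_union_right : B \ A ⊆ symmDiff A B))
  rw [← (finite_Ico _ _).cast_ncard_eq, ← hB.sdiff.cast_ncard_eq]
  have := le_ncard_sdiff A B hA
  rw [Nat.cast_le]
  simpa [ncard_eq_toFinset_card'] using this

lemma volume_Ioi_symmDiff_Iio {a b : ℝ} (ha : 0 ≤ a) (hb : 0 ≤ b) :
    volume.restrict (Ioi 0) (symmDiff (Iio a) (Iio b)) = ENNReal.ofReal |a - b| := by
  wlog h : a ≤ b generalizing a b
  · rw [symmDiff_comm, abs_sub_comm]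
    exact this hb ha (le_of_not_ge h)
  have hI : symmDiff (Iio a) (Iio b) = Ico a b := by
    ext t
    simp only [mem_symmDiff, mem_Iio, mem_Ico]
    grind
  rw [hI, Measure.restrict_congr_set Ioi_ae_eq_Ici, Measure.restrict_apply measurableSet_Ico,
    inter_eq_left.mpr (Ico_subset_Ici_self.trans (Ici_subset_Ici.mpr ha)), Real.volume_Ico, abs_sub_comm,
    abs_of_nonneg (sub_nonneg.mpr h)]

/-- Layer-cake formula for the `ℓ¹` distance of two nonnegative sequences. -/
lemma tsum_ofReal_abs_sub_eq_lintegral {x y : ℕ → ℝ} (hx : ∀ i, 0 ≤ x i) (hy : ∀ i, 0 ≤ y i) :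
    ∑' i, ENNReal.ofReal |x i - y i| =
      ∫⁻ t in Ioi (0 : ℝ), ((symmDiff {i | t < x i} {i | t < y i}).encard : ℝ≥0∞) := by
  have hm : ∀ i, MeasurableSet (symmDiff (Iio (x i)) (Iio (y i))) := fun i =>
    measurableSet_Iio.symmDiff measurableSet_Iio
  simp_rw [← volume_Ioi_symmDiff_Iio (hx _) (hy _), ← lintegral_indicator_one (hm _)]
  rw [← lintegral_tsum fun i => (measurable_one.indicator (hm i)).aemeasurable]
  refine lintegral_congr fun t => ?_
  rw [← ENNReal.tsum_set_one, tsum_subtype _ fun _ => (1 : ℝ≥0∞)]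
  rfl

/-- **Rearrangement contracts ℓ¹ distance**: for summable nonnegative sequences
`p`, `q`, `Σᵢ |p*ᵢ − q*ᵢ| ≤ Σᵢ |pᵢ − qᵢ|`, where `p*`, `q*` are the
nonincreasing rearrangements. -/
theorem rearrangement_contracts_l1 (p q : ℕ → ℝ)
    (hp : ∀ i, 0 ≤ p i) (hq : ∀ i, 0 ≤ q i)
    (hps : Summable p) (hqs : Summable q) :
    (∑' i : ℕ, ENNReal.ofReal |dRearrange p i - dRearrange q i|)
      ≤ ∑' i : ℕ, ENNReal.ofReal |p i - q i| := by
  rw [tsum_ofReal_abs_sub_eq_lintegral (dRearrange_nonneg hp) (dRearrange_nonneg hq),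
    tsum_ofReal_abs_sub_eq_lintegral hp hq]
  refine setLIntegral_mono' measurableSet_Ioi fun t ht => ?_
  simp_rw [lt_dRearrange_iff hp hps ht, lt_dRearrange_iff hq hqs ht]
  exact ENat.toENNReal_le.mpr (encard_symmDiff_Iio_ncard_le
    (finite_superlevel_of_summable hps ht) (finite_superlevel_of_summable hqs ht))

end
end
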